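/- Let V be a normed complex vector space, m ∈ ℝ and ρ ≥ 0, and let F ∈ S^{m,ρ}(ℝ^n, V). Then for each i ∈ {1,…,n}, the partial derivative ∂F/∂x^i belongs to S^{m,ρ}(ℝ^n, V), and the difference quotients converge to it in the S^{m,ρ}-topology: for every multiindex μ ∈ ℕ^n, ‖ (τ_{εe_i}^*F − F)/ε − ∂F/∂x^i ‖^{m,ρ}_μ → 0 as ε → 0, where e_i is the i-th standard basis vector and τ_y^*F(x) := F(x+y). -/

import Mathlib

open Filter MeasureTheory

noncomputable def pder {n : ℕ} {V : Type*} [NormedAddCommGroup V] [NormedSpace ℝ V]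
    (i : Fin n) (f : (Fin n → ℝ) → V) : (Fin n → ℝ) → V :=
  fun x => fderiv ℝ f x (Pi.single i 1)

noncomputable def mder {n : ℕ} {V : Type*} [NormedAddCommGroup V] [NormedSpace ℝ V]
    (μ : Fin n → ℕ) (f : (Fin n → ℝ) → V) : (Fin n → ℝ) → V :=
  (List.finRange n).foldr (fun i g => (pder i)^[μ i] g) f

def mOrder {n : ℕ} (μ : Fin n → ℕ) : ℕ := ∑ i, μ i

noncomputable def symWt {n : ℕ} (m ρ : ℝ) (μ : Fin n → ℕ) (x : Fin n → ℝ) : ℝ :=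
  (1 + ‖x‖ ^ 2) ^ (-(m - ρ * (mOrder μ : ℝ)) / 2)

noncomputable def symNorm {n : ℕ} {V : Type*} [NormedAddCommGroup V] [NormedSpace ℝ V]
    (m ρ : ℝ) (μ : Fin n → ℕ) (F : (Fin n → ℝ) → V) : ℝ :=
  ⨆ x : Fin n → ℝ, symWt m ρ μ x * ‖mder μ F x‖

def IsSymbol {n : ℕ} {V : Type*} [NormedAddCommGroup V] [NormedSpace ℝ V]
    (m ρ : ℝ) (F : (Fin n → ℝ) → V) : Prop :=
  ContDiff ℝ (⊤ : ℕ∞) F ∧ ∀ μ : Fin n → ℕ, ∃ C : ℝ, ∀ x, symWt m ρ μ x * ‖mder μ F x‖ ≤ C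

section PartialDerivatives

variable {n : ℕ} {V : Type*} [NormedAddCommGroup V] [NormedSpace ℝ V]

theorem contDiff_pder (i : Fin n) {f : (Fin n → ℝ) → V} (hf : ContDiff ℝ (⊤ : ℕ∞) f) :
    ContDiff ℝ (⊤ : ℕ∞) (pder i f) :=
  (hf.fderiv_right (m := (⊤ : ℕ∞)) (by simp)).clm_apply contDiff_const

theorem pder_comm (i j : Fin n) {f : (Fin n → ℝ) → V} (hf : ContDiff ℝ (⊤ : ℕ∞) f) :
    pder i (pder j f) = pder j (pder i f) := by
  have hd : Differentiable ℝ (fderiv ℝ f) :=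
    (hf.fderiv_right (m := (⊤ : ℕ∞)) (by simp)).differentiable (by simp)
  have hsnd : ∀ (k : Fin n) (x v : Fin n → ℝ),
      fderiv ℝ (pder k f) x v = fderiv ℝ (fderiv ℝ f) x v (Pi.single k 1) := by
    intro k x v
    have : HasFDerivAt (pder k f) _ x :=
      (hd x).hasFDerivAt.clm_apply (hasFDerivAt_const (Pi.single k (1 : ℝ) : Fin n → ℝ) x)
    rw [this.fderiv]
    simp
  ext x
  have hs : IsSymmSndFDerivAt ℝ f x :=
    hf.contDiffAt.isSymmSndFDerivAt
      (by simpa using WithTop.coe_le_coe.2 (le_top (a := (2 : ℕ∞))))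
  change fderiv ℝ (pder j f) x _ = fderiv ℝ (pder i f) x _
  rw [hsnd, hsnd, hs.eq]

theorem contDiff_pder_iterate (i : Fin n) (k : ℕ) {f : (Fin n → ℝ) → V}
    (hf : ContDiff ℝ (⊤ : ℕ∞) f) : ContDiff ℝ (⊤ : ℕ∞) ((pder i)^[k] f) := by
  induction k with
  | zero => exact hf
  | succ k ih =>
    rw [Function.iterate_succ_apply']
    exact contDiff_pder i ih

theorem contDiff_foldr_pder (μ : Fin n → ℕ) (l : List (Fin n)) {f : (Fin n → ℝ) → V}
    (hf : ContDiff ℝ (⊤ : ℕ∞) f) :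
    ContDiff ℝ (⊤ : ℕ∞) (l.foldr (fun i g => (pder i)^[μ i] g) f) := by
  induction l with
  | nil => exact hf
  | cons a l ih => exact contDiff_pder_iterate a (μ a) ih

theorem contDiff_mder (μ : Fin n → ℕ) {f : (Fin n → ℝ) → V}
    (hf : ContDiff ℝ (⊤ : ℕ∞) f) : ContDiff ℝ (⊤ : ℕ∞) (mder μ f) :=
  contDiff_foldr_pder μ _ hf

theorem pder_iterate_comm_of_comm {T : ((Fin n → ℝ) → V) → (Fin n → ℝ) → V} (i : Fin n)
    (hT : ∀ f, ContDiff ℝ (⊤ : ℕ∞) f → pder i (T f) = T (pder i f))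
    (k : ℕ) {f : (Fin n → ℝ) → V} (hf : ContDiff ℝ (⊤ : ℕ∞) f) :
    (pder i)^[k] (T f) = T ((pder i)^[k] f) := by
  induction k with
  | zero => rfl
  | succ k ih =>
    rw [Function.iterate_succ_apply', Function.iterate_succ_apply', ih,
      hT _ (contDiff_pder_iterate i k hf)]

theorem mder_comm_of_comm {T : ((Fin n → ℝ) → V) → (Fin n → ℝ) → V}
    (hT : ∀ j f, ContDiff ℝ (⊤ : ℕ∞) f → pder j (T f) = T (pder j f))
    (μ : Fin n → ℕ) {f : (Fin n → ℝ) → V} (hf : ContDiff ℝ (⊤ : ℕ∞) f) :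
    mder μ (T f) = T (mder μ f) := by
  unfold mder
  induction List.finRange n with
  | nil => rfl
  | cons a l ih =>
    rw [List.foldr_cons, List.foldr_cons, ih]
    exact pder_iterate_comm_of_comm a (hT a) (μ a) (contDiff_foldr_pder μ l hf)

theorem mder_pder (i : Fin n) (μ : Fin n → ℕ) {f : (Fin n → ℝ) → V}
    (hf : ContDiff ℝ (⊤ : ℕ∞) f) : mder μ (pder i f) = pder i (mder μ f) :=
  mder_comm_of_comm (fun j _ hg => pder_comm j i hg) μ hf

theorem foldr_pder_add_single_of_notMem (i : Fin n) (μ : Fin n → ℕ) {l : List (Fin n)}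
    (hl : i ∉ l) (f : (Fin n → ℝ) → V) :
    l.foldr (fun j g => (pder j)^[(μ + Pi.single i 1 : Fin n → ℕ) j] g) f =
      l.foldr (fun j g => (pder j)^[μ j] g) f := by
  induction l with
  | nil => rfl
  | cons a l ih =>
    rw [List.mem_cons, not_or] at hl
    rw [List.foldr_cons, List.foldr_cons, ih hl.2]
    simp [Pi.single_eq_of_ne (Ne.symm hl.1)]

theorem foldr_pder_add_single_of_mem (i : Fin n) (μ : Fin n → ℕ) {l : List (Fin n)}
    (hnd : l.Nodup) (hl : i ∈ l) {f : (Fin n → ℝ) → V} (hf : ContDiff ℝ (⊤ : ℕ∞) f) :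
    l.foldr (fun j g => (pder j)^[(μ + Pi.single i 1 : Fin n → ℕ) j] g) f =
      pder i (l.foldr (fun j g => (pder j)^[μ j] g) f) := by
  induction l with
  | nil => simp at hl
  | cons a l ih =>
    rw [List.nodup_cons] at hnd
    rw [List.foldr_cons, List.foldr_cons]
    by_cases h : i = a
    · subst h
      rw [foldr_pder_add_single_of_notMem i μ hnd.1, ← Function.iterate_succ_apply' (pder i)]
      simp
    · rw [ih hnd.2 ((List.mem_cons.1 hl).resolve_left h)]
      have hμ : (μ + Pi.single i 1 : Fin n → ℕ) a = μ a := by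
        simp [Pi.single_eq_of_ne (Ne.symm h)]
      rw [hμ]
      exact pder_iterate_comm_of_comm (T := pder i) a (fun _ hg => pder_comm a i hg) (μ a)
        (contDiff_foldr_pder μ l hf)

theorem mder_add_single (i : Fin n) (μ : Fin n → ℕ) {f : (Fin n → ℝ) → V}
    (hf : ContDiff ℝ (⊤ : ℕ∞) f) : mder (μ + Pi.single i 1) f = pder i (mder μ f) :=
  foldr_pder_add_single_of_mem i μ (List.nodup_finRange n) (List.mem_finRange i) hf

/-- The error made when the `i`-th partial derivative is replaced by a difference quotient. -/
noncomputable def diffQuotError (i : Fin n) (ε : ℝ) (f : (Fin n → ℝ) → V) : (Fin n → ℝ) → V :=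
  fun x => ε⁻¹ • (f (x + ε • (Pi.single i (1 : ℝ) : Fin n → ℝ)) - f x) - pder i f x

theorem pder_diffQuotError (i j : Fin n) (ε : ℝ) {f : (Fin n → ℝ) → V}
    (hf : ContDiff ℝ (⊤ : ℕ∞) f) :
    pder j (diffQuotError i ε f) = diffQuotError i ε (pder j f) := by
  ext x
  have hd : Differentiable ℝ f := hf.differentiable (by simp)
  have hp : Differentiable ℝ (pder i f) := (contDiff_pder i hf).differentiable (by simp)
  have h1 : HasFDerivAt (diffQuotError i ε f) _ x :=
    ((((hd _).hasFDerivAt.comp x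
      ((hasFDerivAt_id x).add_const (ε • (Pi.single i (1 : ℝ) : Fin n → ℝ)))).sub
      (hd x).hasFDerivAt).const_smul ε⁻¹).sub (hp x).hasFDerivAt
  have h2 : pder j (pder i f) x = pder i (pder j f) x := by rw [pder_comm j i hf]
  change fderiv ℝ (diffQuotError i ε f) x _ = _
  rw [h1.fderiv]
  simp only [diffQuotError, ← h2]
  rfl

theorem mder_diffQuotError (i : Fin n) (ε : ℝ) (μ : Fin n → ℕ) {f : (Fin n → ℝ) → V}
    (hf : ContDiff ℝ (⊤ : ℕ∞) f) :
    mder μ (diffQuotError i ε f) = diffQuotError i ε (mder μ f) :=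
  mder_comm_of_comm (fun j _ hg => pder_diffQuotError i j ε hg) μ hf

theorem hasDerivAt_comp_add_smul_single (i : Fin n) {f : (Fin n → ℝ) → V}
    (hf : Differentiable ℝ f) (x : Fin n → ℝ) (t : ℝ) :
    HasDerivAt (fun s : ℝ => f (x + s • (Pi.single i (1 : ℝ) : Fin n → ℝ)))
      (pder i f (x + t • Pi.single i (1 : ℝ))) t := by
  have h : HasDerivAt (fun s : ℝ => x + s • (Pi.single i (1 : ℝ) : Fin n → ℝ))
      (Pi.single i (1 : ℝ)) t := by
    simpa using ((hasDerivAt_id t).smul_const (Pi.single i (1 : ℝ) : Fin n → ℝ)).const_add x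
  exact (hf _).hasFDerivAt.comp_hasDerivAt t h

theorem norm_diffQuotError_le (i : Fin n) {f : (Fin n → ℝ) → V}
    (hf : ContDiff ℝ (⊤ : ℕ∞) f) {ε : ℝ} (hε : ε ≠ 0) (x : Fin n → ℝ) {M : ℝ}
    (hM : ∀ t : ℝ, |t| ≤ |ε| → ‖pder i (pder i f) (x + t • Pi.single i (1 : ℝ))‖ ≤ M) :
    ‖diffQuotError i ε f x‖ ≤ |ε| * M := by
  have hd : Differentiable ℝ f := hf.differentiable (by simp)
  have hp : Differentiable ℝ (pder i f) := (contDiff_pder i hf).differentiable (by simp)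
  have hM0 : 0 ≤ M := (norm_nonneg _).trans (hM 0 (by simp))
  have hmem : ∀ t : ℝ, t ∈ Metric.closedBall (0 : ℝ) |ε| ↔ |t| ≤ |ε| := by simp
  have hconv : Convex ℝ (Metric.closedBall (0 : ℝ) |ε|) := convex_closedBall _ _
  have h0 : (0 : ℝ) ∈ Metric.closedBall (0 : ℝ) |ε| := (hmem 0).2 (by simp)
  have hfirst : ∀ t ∈ Metric.closedBall (0 : ℝ) |ε|,
      ‖pder i f (x + t • Pi.single i (1 : ℝ)) - pder i f x‖ ≤ |ε| * M := by
    intro t ht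
    have := hconv.norm_image_sub_le_of_norm_hasDerivWithin_le
      (fun s _ => (hasDerivAt_comp_add_smul_single i hp x s).hasDerivWithinAt)
      (fun s hs => hM s ((hmem s).1 hs)) h0 ht
    simp only [zero_smul, add_zero, sub_zero, Real.norm_eq_abs] at this
    calc _ ≤ M * |t| := this
      _ ≤ M * |ε| := mul_le_mul_of_nonneg_left ((hmem t).1 ht) hM0
      _ = |ε| * M := mul_comm _ _
  have hsecond := hconv.norm_image_sub_le_of_norm_hasDerivWithin_le
    (f := fun s : ℝ => f (x + s • (Pi.single i (1 : ℝ) : Fin n → ℝ)) - s • pder i f x)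
    (fun s _ => ((hasDerivAt_comp_add_smul_single i hd x s).sub
      (by simpa using (hasDerivAt_id s).smul_const (pder i f x))).hasDerivWithinAt)
    hfirst h0 ((hmem ε).2 le_rfl)
  have hquot : diffQuotError i ε f x =
      ε⁻¹ • (f (x + ε • (Pi.single i (1 : ℝ) : Fin n → ℝ)) - ε • pder i f x - f x) := by
    rw [diffQuotError, sub_right_comm, smul_sub _ _ (ε • pder i f x), inv_smul_smul₀ hε]
  simp only [zero_smul, add_zero, sub_zero, Real.norm_eq_abs] at hsecond
  rw [hquot, norm_smul, norm_inv, Real.norm_eq_abs, inv_mul_le_iff₀ (abs_pos.2 hε), mul_comm]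
  exact hsecond

end PartialDerivatives

section Weights

variable {n : ℕ}

theorem symWt_pos (m ρ : ℝ) (μ : Fin n → ℕ) (x : Fin n → ℝ) : 0 < symWt m ρ μ x :=
  Real.rpow_pos_of_pos (by positivity) _

theorem symWt_le_symWt_add_single (m : ℝ) {ρ : ℝ} (hρ : 0 ≤ ρ) (μ : Fin n → ℕ) (i : Fin n)
    (x : Fin n → ℝ) : symWt m ρ μ x ≤ symWt m ρ (μ + Pi.single i 1) x := by
  have h : mOrder (μ + Pi.single i 1) = mOrder μ + 1 := by
    simp [mOrder, Finset.sum_add_distrib]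
  refine Real.rpow_le_rpow_of_exponent_le (by nlinarith [sq_nonneg ‖x‖]) ?_
  rw [h]
  push_cast
  linarith

theorem one_add_norm_sq_le {E : Type*} [SeminormedAddCommGroup E] {x y : E} (h : ‖x - y‖ ≤ 1) :
    1 + ‖x‖ ^ 2 ≤ 3 * (1 + ‖y‖ ^ 2) := by
  have h1 : ‖x‖ ≤ ‖y‖ + 1 := by linarith [norm_sub_norm_le x y]
  nlinarith [norm_nonneg x, norm_nonneg y, sq_nonneg (‖y‖ - 1)]

theorem rpow_le_rpow_abs_mul_rpow {a b c : ℝ} (ha : 0 < a) (hb : 0 < b) (hc : 0 < c)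
    (hab : a ≤ c * b) (hba : b ≤ c * a) (s : ℝ) : a ^ s ≤ c ^ |s| * b ^ s := by
  rcases le_total 0 s with hs | hs
  · rw [abs_of_nonneg hs, ← Real.mul_rpow hc.le hb.le]
    exact Real.rpow_le_rpow ha.le hab hs
  · rw [abs_of_nonpos hs, Real.rpow_neg hc.le, ← Real.inv_rpow hc.le,
      ← Real.mul_rpow (inv_pos.2 hc).le hb.le]
    refine Real.rpow_le_rpow_of_nonpos (by positivity) ?_ hs
    rwa [inv_mul_le_iff₀ hc]

theorem exists_symWt_le (m ρ : ℝ) (μ : Fin n → ℕ) :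
    ∃ K : ℝ, 0 ≤ K ∧ ∀ x y : Fin n → ℝ, ‖y‖ ≤ 1 → symWt m ρ μ x ≤ K * symWt m ρ μ (x + y) := by
  refine ⟨3 ^ |-(m - ρ * (mOrder μ : ℝ)) / 2|, by positivity, fun x y hy => ?_⟩
  refine rpow_le_rpow_abs_mul_rpow (by positivity) (by positivity) three_pos
    (one_add_norm_sq_le ?_) (one_add_norm_sq_le ?_) _ <;> simpa using hy

end Weights

theorem isSymbol_pder {n : ℕ} {V : Type*} [NormedAddCommGroup V] [NormedSpace ℝ V]
    {m ρ : ℝ} (hρ : 0 ≤ ρ) {F : (Fin n → ℝ) → V} (hF : IsSymbol m ρ F) (i : Fin n) :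
    IsSymbol m ρ (pder i F) := by
  refine ⟨contDiff_pder i hF.1, fun μ => ?_⟩
  obtain ⟨C, hC⟩ := hF.2 (μ + Pi.single i 1)
  refine ⟨C, fun x => le_trans ?_ (hC x)⟩
  rw [mder_pder i μ hF.1, mder_add_single i μ hF.1]
  gcongr
  exact symWt_le_symWt_add_single m hρ μ i x

theorem statement9 {n : ℕ} {V : Type*} [NormedAddCommGroup V] [NormedSpace ℝ V]
    [NormedSpace ℂ V] [IsScalarTower ℝ ℂ V]
    (m ρ : ℝ) (hρ : 0 ≤ ρ) (F : (Fin n → ℝ) → V) (hF : IsSymbol m ρ F) (i : Fin n) :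
    IsSymbol m ρ (pder i F) ∧
    ∀ μ : Fin n → ℕ,
      Tendsto (fun ε : ℝ =>
          symNorm m ρ μ (fun x =>
            ε⁻¹ • (F (x + ε • (Pi.single i (1 : ℝ) : Fin n → ℝ)) - F x) - pder i F x))
        (nhdsWithin 0 {(0 : ℝ)}ᶜ) (nhds 0) := by
  refine ⟨isSymbol_pder hρ hF i, fun μ => ?_⟩
  have hG : ContDiff ℝ (⊤ : ℕ∞) (mder μ F) := contDiff_mder μ hF.1
  obtain ⟨C, hC⟩ := (isSymbol_pder hρ (isSymbol_pder hρ hF i) i).2 μ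
  have hC' : ∀ z, symWt m ρ μ z * ‖pder i (pder i (mder μ F)) z‖ ≤ C := by
    intro z
    have := hC z
    rwa [mder_pder i μ (contDiff_pder i hF.1), mder_pder i μ hF.1] at this
  obtain ⟨K, hK0, hK⟩ := exists_symWt_le m ρ μ
  have key : ∀ ε : ℝ, ε ≠ 0 → |ε| ≤ 1 → ∀ x,
      symWt m ρ μ x * ‖diffQuotError i ε (mder μ F) x‖ ≤ |ε| * (K * C) := by
    intro ε hε hε1 x
    have hw := symWt_pos m ρ μ x
    have hM : ∀ t : ℝ, |t| ≤ |ε| →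
        ‖pder i (pder i (mder μ F)) (x + t • Pi.single i (1 : ℝ))‖ ≤ K * C / symWt m ρ μ x := by
      intro t ht
      rw [le_div_iff₀ hw]
      have hd : ‖t • (Pi.single i (1 : ℝ) : Fin n → ℝ)‖ ≤ 1 := by
        rw [norm_smul, Pi.norm_single]
        simpa using ht.trans hε1
      calc _ ≤ ‖pder i (pder i (mder μ F)) (x + t • Pi.single i (1 : ℝ))‖ *
            (K * symWt m ρ μ (x + t • Pi.single i (1 : ℝ))) := by
              gcongr
              exact hK x _ hd
        _ = K * (symWt m ρ μ (x + t • Pi.single i (1 : ℝ)) *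
            ‖pder i (pder i (mder μ F)) (x + t • Pi.single i (1 : ℝ))‖) := by ring
        _ ≤ K * C := by
              gcongr
              exact hC' _
    calc _ ≤ symWt m ρ μ x * (|ε| * (K * C / symWt m ρ μ x)) := by
            gcongr
            exact norm_diffQuotError_le i hG hε x hM
      _ = |ε| * (K * C) := by field_simp
  have hlim : Tendsto (fun ε : ℝ => |ε| * (K * C)) (nhdsWithin 0 {(0 : ℝ)}ᶜ) (nhds 0) := by
    have : Continuous fun ε : ℝ => |ε| * (K * C) := by fun_prop
    exact (this.tendsto' 0 0 (by simp)).mono_left nhdsWithin_le_nhds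
  have hsmall : ∀ᶠ ε : ℝ in nhdsWithin 0 {(0 : ℝ)}ᶜ, |ε| ≤ 1 := by
    refine nhdsWithin_le_nhds ?_
    filter_upwards [Metric.closedBall_mem_nhds (0 : ℝ) one_pos] with ε hε
    simpa using hε
  refine squeeze_zero' (Eventually.of_forall fun ε => Real.iSup_nonneg fun x =>
    mul_nonneg (symWt_pos m ρ μ x).le (norm_nonneg _)) ?_ hlim
  filter_upwards [hsmall, self_mem_nhdsWithin] with ε hε1 hε
  refine ciSup_le fun x => ?_
  have := key ε hε hε1 x
  rwa [← mder_diffQuotError i ε μ hF.1] at this
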